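/- arXiv:2403.02476 — 5 statements merged into one kernel-verified Lean document; each statement's English description precedes it below -/
import Mathlib

section
/- Let S be a finite set of size n, let P be an S×S row-stochastic matrix with stationary distribution π, let D = diag(π), let γ ∈ (0,1), let Φ be an n×K real matrix, and define Ā = Φᵀ D (γP − I) Φ and b̄ = −Φᵀ D R for a fixed vector R ∈ ℝ^S, so that ḡ(θ) = Ā θ − b̄. Suppose θ* ∈ ℝ^K satisfies ḡ(θ*) = 0. Then for every θ ∈ ℝ^K, ⟨θ − θ*, ḡ(θ)⟩ ≤ −(1−γ) ‖Φ(θ − θ*)‖_D², where ‖z‖_D² = zᵀ D z. -/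
open Matrix

/-- A row-stochastic matrix is nonexpansive in the quadratic form weighted by a nonnegative
stationary vector: `xᵀ D P x ≤ xᵀ D x`. -/
theorem dotProduct_diagonal_mulVec_stochastic_le
    {S : Type*} [Fintype S] [DecidableEq S] {P : Matrix S S ℝ} {w : S → ℝ}
    (hP_nonneg : ∀ s t, 0 ≤ P s t) (hP_row : ∀ s, ∑ t, P s t = 1)
    (hw_nonneg : ∀ s, 0 ≤ w s) (hw : w ᵥ* P = w) (x : S → ℝ) :
    x ⬝ᵥ (diagonal w *ᵥ (P *ᵥ x)) ≤ x ⬝ᵥ (diagonal w *ᵥ x) := by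
  have row : ∑ s, ∑ t, w s * P s t * x s ^ 2 = ∑ s, w s * x s ^ 2 := by
    refine Finset.sum_congr rfl fun s _ => ?_
    rw [← Finset.sum_mul, ← Finset.mul_sum, hP_row, mul_one]
  have col : ∑ s, ∑ t, w s * P s t * x t ^ 2 = ∑ s, w s * x s ^ 2 := by
    rw [Finset.sum_comm]
    refine Finset.sum_congr rfl fun t _ => ?_
    rw [← Finset.sum_mul]
    exact congrArg (· * x t ^ 2) (congrFun hw t)
  calc x ⬝ᵥ (diagonal w *ᵥ (P *ᵥ x))
      = ∑ s, ∑ t, w s * P s t * (x s * x t) := by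
        simp only [dotProduct, mulVec_diagonal]
        simp only [mulVec, dotProduct, Finset.mul_sum]
        exact Finset.sum_congr rfl fun s _ => Finset.sum_congr rfl fun t _ => by ring
    _ ≤ ∑ s, ∑ t, (w s * P s t * x s ^ 2 + w s * P s t * x t ^ 2) / 2 := by
        refine Finset.sum_le_sum fun s _ => Finset.sum_le_sum fun t _ => ?_
        nlinarith [mul_nonneg (mul_nonneg (hw_nonneg s) (hP_nonneg s t)) (sq_nonneg (x s - x t))]
    _ = ∑ s, w s * x s ^ 2 := by
        simp only [← Finset.sum_div, Finset.sum_add_distrib, row, col]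
        ring
    _ = x ⬝ᵥ (diagonal w *ᵥ x) := by
        simp only [dotProduct, mulVec_diagonal]
        exact Finset.sum_congr rfl fun s _ => by ring

/-- For the steady-state TD(0) direction
`ḡ(θ) = Ā θ − b̄` with `Ā = Φᵀ D (γP − I) Φ`, `b̄ = −Φᵀ D R`, and `ḡ(θ*) = 0`,
we have `⟨θ − θ*, ḡ(θ)⟩ ≤ −(1−γ) ‖Φ(θ − θ*)‖_D²` for every `θ`. -/
theorem steady_state_td_direction_negative_alignment
    {S : Type*} [Fintype S] [DecidableEq S] {K : ℕ}
    (P : Matrix S S ℝ) (pr : S → ℝ)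
    (hP_nonneg : ∀ s s', 0 ≤ P s s')
    (hP_row : ∀ s, ∑ s', P s s' = 1)
    (hpr_nonneg : ∀ s, 0 ≤ pr s)
    (hpr_sum : ∑ s, pr s = 1)
    (hstat : Matrix.vecMul pr P = pr)
    (γ : ℝ) (hγ : γ ∈ Set.Ioo (0 : ℝ) 1)
    (Φ : Matrix S (Fin K) ℝ) (R : S → ℝ)
    (Abar : Matrix (Fin K) (Fin K) ℝ)
    (hAbar : Abar = Φᵀ * Matrix.diagonal pr * (γ • P - 1) * Φ)
    (bbar : Fin K → ℝ)
    (hbbar : bbar = -((Φᵀ * Matrix.diagonal pr) *ᵥ R))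
    (gbar : (Fin K → ℝ) → (Fin K → ℝ))
    (hgbar : ∀ θ, gbar θ = Abar *ᵥ θ - bbar)
    (θstar : Fin K → ℝ) (hθstar : gbar θstar = 0)
    (θ : Fin K → ℝ) :
    (θ - θstar) ⬝ᵥ gbar θ ≤
      -(1 - γ) * ((Φ *ᵥ (θ - θstar)) ⬝ᵥ (Matrix.diagonal pr *ᵥ (Φ *ᵥ (θ - θstar)))) := by
  have linear : gbar θ = Abar *ᵥ (θ - θstar) := by
    rw [hgbar, sub_eq_zero] at hθstar
    rw [hgbar, mulVec_sub, hθstar]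
  set x := Φ *ᵥ (θ - θstar) with hx
  have quadratic : (θ - θstar) ⬝ᵥ gbar θ =
      γ * (x ⬝ᵥ (diagonal pr *ᵥ (P *ᵥ x))) - x ⬝ᵥ (diagonal pr *ᵥ x) := by
    rw [linear, hAbar]
    simp only [← mulVec_mulVec, ← hx]
    rw [dotProduct_mulVec, vecMul_transpose, ← hx, sub_mulVec, smul_mulVec, one_mulVec,
      mulVec_sub, mulVec_smul, dotProduct_sub, dotProduct_smul, smul_eq_mul]
  have nonexpansive := mul_le_mul_of_nonneg_left
    (dotProduct_diagonal_mulVec_stochastic_le hP_nonneg hP_row hpr_nonneg hstat x) hγ.1.le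
  rw [quadratic]
  linarith
end

section
/- Let S be a finite set of size n, let P be an S×S row-stochastic matrix with stationary distribution π, let D = diag(π), let γ ∈ (0,1), let Φ be an n×K real matrix, define Σ = Φᵀ D Φ, and suppose ω > 0 satisfies vᵀ Σ v ≥ ω ‖v‖² for all v ∈ ℝ^K (ω is a lower bound on the smallest eigenvalue of Σ). Define ḡ(θ) = Ā θ − b̄ with Ā = Φᵀ D (γP − I) Φ and b̄ = −Φᵀ D R for a fixed R ∈ ℝ^S, and suppose ḡ(θ*) = 0. Then for every θ ∈ ℝ^K, ⟨θ* − θ, ḡ(θ)⟩ ≥ ω(1−γ) ‖θ* − θ‖². -/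
open Matrix

/-- For a row-stochastic matrix `P` with stationary weights `w`, the bilinear form
`⟨u, P u⟩` weighted by `w` is bounded by the weighted square norm of `u`. -/
theorem dotProduct_diagonal_mulVec_le_of_stationary {S : Type*} [Fintype S] [DecidableEq S]
    {P : Matrix S S ℝ} {w : S → ℝ} (hP : ∀ s s', 0 ≤ P s s') (hrow : ∀ s, ∑ s', P s s' = 1)
    (hw : ∀ s, 0 ≤ w s) (hstat : w ᵥ* P = w) (u : S → ℝ) :
    u ⬝ᵥ (diagonal w *ᵥ (P *ᵥ u)) ≤ u ⬝ᵥ (diagonal w *ᵥ u) := by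
  have hcol : ∑ s, ∑ s', w s * P s s' * u s' ^ 2 = ∑ s, w s * u s ^ 2 := by
    rw [Finset.sum_comm]
    refine Finset.sum_congr rfl fun s' _ => ?_
    rw [← Finset.sum_mul]
    congr 1
    exact congrFun hstat s'
  have hsum : ∑ s, ∑ s', w s * P s s' * u s ^ 2 = ∑ s, w s * u s ^ 2 := by
    refine Finset.sum_congr rfl fun s _ => ?_
    rw [← Finset.sum_mul, ← Finset.mul_sum, hrow, mul_one]
  calc u ⬝ᵥ (diagonal w *ᵥ (P *ᵥ u)) = ∑ s, ∑ s', w s * P s s' * (u s * u s') := by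
        simp only [dotProduct, mulVec_diagonal]
        refine Finset.sum_congr rfl fun s _ => ?_
        simp only [mulVec, dotProduct, Finset.mul_sum]
        exact Finset.sum_congr rfl fun s' _ => by ring
    _ ≤ ∑ s, ∑ s', (w s * P s s' * u s ^ 2 + w s * P s s' * u s' ^ 2) / 2 := by
        refine Finset.sum_le_sum fun s _ => Finset.sum_le_sum fun s' _ => ?_
        nlinarith [mul_nonneg (mul_nonneg (hw s) (hP s s')) (sq_nonneg (u s - u s'))]
    _ = ∑ s, w s * u s ^ 2 := by
        simp only [← Finset.sum_div, Finset.sum_add_distrib, hcol, hsum]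
        ring
    _ = u ⬝ᵥ (diagonal w *ᵥ u) := by
        simp only [dotProduct, mulVec_diagonal]
        exact Finset.sum_congr rfl fun s _ => by ring

/-- (Lemma 1 of the paper.) If `Σ = Φᵀ D Φ` satisfies
`vᵀ Σ v ≥ ω ‖v‖²` for all `v` with `ω > 0`, then the steady-state TD(0)
direction `ḡ(θ) = Ā θ − b̄` (with `ḡ(θ*) = 0`) satisfies
`⟨θ* − θ, ḡ(θ)⟩ ≥ ω(1−γ) ‖θ* − θ‖²` for every `θ`. -/
theorem steady_state_td_direction_pseudo_gradient
    {S : Type*} [Fintype S] [DecidableEq S] {K : ℕ}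
    (P : Matrix S S ℝ) (pr : S → ℝ)
    (hP_nonneg : ∀ s s', 0 ≤ P s s')
    (hP_row : ∀ s, ∑ s', P s s' = 1)
    (hpr_nonneg : ∀ s, 0 ≤ pr s)
    (hpr_sum : ∑ s, pr s = 1)
    (hstat : Matrix.vecMul pr P = pr)
    (γ : ℝ) (hγ : γ ∈ Set.Ioo (0 : ℝ) 1)
    (Φ : Matrix S (Fin K) ℝ) (R : S → ℝ)
    (ω : ℝ) (hω : 0 < ω)
    (hSigma : ∀ v : Fin K → ℝ, ω * (v ⬝ᵥ v) ≤ v ⬝ᵥ ((Φᵀ * Matrix.diagonal pr * Φ) *ᵥ v))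
    (Abar : Matrix (Fin K) (Fin K) ℝ)
    (hAbar : Abar = Φᵀ * Matrix.diagonal pr * (γ • P - 1) * Φ)
    (bbar : Fin K → ℝ)
    (hbbar : bbar = -((Φᵀ * Matrix.diagonal pr) *ᵥ R))
    (gbar : (Fin K → ℝ) → (Fin K → ℝ))
    (hgbar : ∀ θ, gbar θ = Abar *ᵥ θ - bbar)
    (θstar : Fin K → ℝ) (hθstar : gbar θstar = 0)
    (θ : Fin K → ℝ) :
    (θstar - θ) ⬝ᵥ gbar θ ≥ ω * (1 - γ) * ((θstar - θ) ⬝ᵥ (θstar - θ)) := by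
  set v := θstar - θ with hv
  have hg : gbar θ = -(Abar *ᵥ v) := by
    have h : Abar *ᵥ θstar = bbar := by
      rw [← sub_eq_zero, ← hgbar, hθstar]
    rw [hgbar, hv, mulVec_sub, h, neg_sub]
  clear_value v
  have hadj : ∀ x : S → ℝ, v ⬝ᵥ (Φᵀ *ᵥ x) = (Φ *ᵥ v) ⬝ᵥ x := fun x => by
    rw [dotProduct_mulVec, vecMul_transpose]
  have hS := hSigma v
  rw [← mulVec_mulVec, ← mulVec_mulVec, hadj] at hS
  have hP := dotProduct_diagonal_mulVec_le_of_stationary hP_nonneg hP_row hpr_nonneg hstat (Φ *ᵥ v)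
  rw [hg, hAbar, ← mulVec_mulVec, ← mulVec_mulVec, ← mulVec_mulVec, dotProduct_neg, hadj,
    sub_mulVec, one_mulVec, smul_mulVec, mulVec_sub (diagonal pr), mulVec_smul, dotProduct_sub,
    dotProduct_smul, smul_eq_mul]
  have h1 := mul_le_mul_of_nonneg_left hP hγ.1.le
  have h2 := mul_le_mul_of_nonneg_left hS (sub_nonneg.2 hγ.2.le)
  linarith
end

section
/- Let θ*, θ ∈ ℝ^K, let σ ≥ 0, ω(1−γ) > 0, and α > 0, and let g, ḡ : ℝ^K → ℝ^K satisfy ‖g(θ)‖ ≤ 2‖θ − θ*‖ + 4σ and ⟨θ* − θ, ḡ(θ)⟩ ≥ ω(1−γ)‖θ* − θ‖². Then the updated point θ⁺ = θ + α g(θ) satisfies ‖θ⁺ − θ*‖² ≤ (1 − 2αω(1−γ) + 8α²) ‖θ − θ*‖² + 32α²σ² + 2α ⟨θ − θ*, g(θ) − ḡ(θ)⟩. -/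
open RealInnerProductSpace

/-- One-step recursion for TD(0): if
`‖g(θ)‖ ≤ 2‖θ − θ*‖ + 4σ` and `⟨θ* − θ, ḡ(θ)⟩ ≥ ω(1−γ)‖θ* − θ‖²`, then
the updated point `θ⁺ = θ + α g(θ)` satisfies the main recursion
inequality. -/
theorem td_one_step_recursion
    {K : ℕ} (θstar θ : EuclideanSpace ℝ (Fin K))
    (σ ω γ α : ℝ) (hσ : 0 ≤ σ) (hA : 0 < ω * (1 - γ)) (hα : 0 < α)
    (g gbar : EuclideanSpace ℝ (Fin K) → EuclideanSpace ℝ (Fin K))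
    (hg : ‖g θ‖ ≤ 2 * ‖θ - θstar‖ + 4 * σ)
    (hgbar : ⟪θstar - θ, gbar θ⟫ ≥ ω * (1 - γ) * ‖θstar - θ‖ ^ 2) :
    ‖(θ + α • g θ) - θstar‖ ^ 2 ≤
      (1 - 2 * α * ω * (1 - γ) + 8 * α ^ 2) * ‖θ - θstar‖ ^ 2 +
        32 * α ^ 2 * σ ^ 2 + 2 * α * ⟪θ - θstar, g θ - gbar θ⟫ := by
  have hg_sq : ‖g θ‖ ^ 2 ≤ 8 * ‖θ - θstar‖ ^ 2 + 32 * σ ^ 2 := by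
    have h := pow_le_pow_left₀ (norm_nonneg (g θ)) hg 2
    nlinarith [sq_nonneg (2 * ‖θ - θstar‖ - 4 * σ)]
  have h_inner : ⟪θ - θstar, gbar θ⟫ ≤ -(ω * (1 - γ) * ‖θ - θstar‖ ^ 2) := by
    rw [← neg_sub θ θstar, inner_neg_left, norm_neg] at hgbar
    linarith
  have h_expand : ‖(θ + α • g θ) - θstar‖ ^ 2 =
      ‖θ - θstar‖ ^ 2 + 2 * α * ⟪θ - θstar, g θ⟫ + α ^ 2 * ‖g θ‖ ^ 2 := by
    rw [add_sub_right_comm, norm_add_sq_real, real_inner_smul_right, norm_smul, mul_pow,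
      Real.norm_eq_abs, sq_abs]
    ring
  rw [h_expand, inner_sub_right]
  have h_quad := mul_le_mul_of_nonneg_left hg_sq (sq_nonneg α)
  have h_lin := mul_le_mul_of_nonneg_left h_inner hα.le
  linarith
end

section
/- Let (Ω, ℱ, ℙ) be a probability space, θ* ∈ ℝ^K, σ ≥ 0, B ≥ σ², α > 0, and let τ, t be integers with 1 ≤ τ ≤ t. Let (θ_k)_{k≥0} be measurable random vectors θ_k : Ω → ℝ^K with ‖θ_k − θ*‖² integrable, satisfying pointwise the recursion θ_{k+1}(ω) = θ_k(ω) + α g_k(ω, θ_k(ω)) where each g_k satisfies ‖g_k(ω, θ)‖ ≤ 2‖θ − θ*‖ + 4σ for all ω and θ. If 𝔼[‖θ_k − θ*‖²] ≤ B for every k ∈ {0, 1, …, t}, then 𝔼[‖θ_t − θ_{t−τ}‖²] ≤ 40 α² τ² B. -/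
open MeasureTheory

/-- Pathwise bound on the squared displacement, over `n` steps, of a recursion whose increments
grow at most linearly in the distance to `c`. -/
lemma norm_sub_sq_le_of_linear_growth {E : Type*} [NormedAddCommGroup E] [NormedSpace ℝ E]
    (x v : ℕ → E) (c : E) (σ α : ℝ)
    (hrec : ∀ k, x (k + 1) = x k + α • v k)
    (hv : ∀ k, ‖v k‖ ≤ 2 * ‖x k - c‖ + 4 * σ) (s n : ℕ) :
    ‖x (s + n) - x s‖ ^ 2 ≤
      α ^ 2 * n * ∑ i ∈ Finset.range n, (8 * ‖x (s + i) - c‖ ^ 2 + 32 * σ ^ 2) := by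
  have hsum : x (s + n) - x s = α • ∑ i ∈ Finset.range n, v (s + i) := by
    rw [Finset.smul_sum, ← add_zero s, add_assoc, zero_add,
      ← Finset.sum_range_sub (fun i => x (s + i)) n]
    refine Finset.sum_congr rfl fun i _ => ?_
    simp only [← add_assoc, hrec, add_zero, add_sub_cancel_left]
  rw [hsum, norm_smul, mul_pow, Real.norm_eq_abs, sq_abs, mul_assoc]
  refine mul_le_mul_of_nonneg_left ?_ (sq_nonneg α)
  calc ‖∑ i ∈ Finset.range n, v (s + i)‖ ^ 2
      ≤ (∑ i ∈ Finset.range n, ‖v (s + i)‖) ^ 2 := by gcongr; exact norm_sum_le _ _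
    _ ≤ n * ∑ i ∈ Finset.range n, ‖v (s + i)‖ ^ 2 := by
        simpa using sq_sum_le_card_mul_sum_sq (s := Finset.range n) (f := fun i => ‖v (s + i)‖)
    _ ≤ _ := by
        gcongr with i
        calc ‖v (s + i)‖ ^ 2 ≤ (2 * ‖x (s + i) - c‖ + 4 * σ) ^ 2 := by gcongr; exact hv _
          _ ≤ _ := by nlinarith [sq_nonneg (2 * ‖x (s + i) - c‖ - 4 * σ)]

/-- (Lemma 3 of the paper: drift bound.) If the random
iterates follow `θ_{k+1} = θ_k + α g_k(·, θ_k)` with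
`‖g_k(ω, θ)‖ ≤ 2‖θ − θ*‖ + 4σ`, and `𝔼[‖θ_k − θ*‖²] ≤ B` for all `k ≤ t`
(with `σ² ≤ B`, `1 ≤ τ ≤ t`), then `𝔼[‖θ_t − θ_{t−τ}‖²] ≤ 40 α² τ² B`. -/
theorem td_iterate_drift_bound
    {K : ℕ} {Ω : Type*} [MeasurableSpace Ω]
    (μ : Measure Ω) [IsProbabilityMeasure μ]
    (θstar : EuclideanSpace ℝ (Fin K)) (σ B α : ℝ) (τ t : ℕ)
    (hσ : 0 ≤ σ) (hσB : σ ^ 2 ≤ B) (hα : 0 < α) (hτ : 1 ≤ τ) (hτt : τ ≤ t)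
    (θ : ℕ → Ω → EuclideanSpace ℝ (Fin K))
    (g : ℕ → Ω → EuclideanSpace ℝ (Fin K) → EuclideanSpace ℝ (Fin K))
    (hmeas : ∀ k, Measurable (θ k))
    (hint : ∀ k, Integrable (fun ω => ‖θ k ω - θstar‖ ^ 2) μ)
    (hrec : ∀ k ω, θ (k + 1) ω = θ k ω + α • g k ω (θ k ω))
    (hg : ∀ k ω x, ‖g k ω x‖ ≤ 2 * ‖x - θstar‖ + 4 * σ)
    (hmoment : ∀ k ≤ t, ∫ ω, ‖θ k ω - θstar‖ ^ 2 ∂μ ≤ B) :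
    ∫ ω, ‖θ t ω - θ (t - τ) ω‖ ^ 2 ∂μ ≤ 40 * α ^ 2 * (τ : ℝ) ^ 2 * B := by
  obtain ⟨s, rfl⟩ := Nat.exists_eq_add_of_le' hτt
  rw [Nat.add_sub_cancel]
  have hterm : ∀ i, Integrable (fun ω => 8 * ‖θ (s + i) ω - θstar‖ ^ 2 + 32 * σ ^ 2) μ :=
    fun i => ((hint _).const_mul 8).add (integrable_const _)
  have hbound : ∀ i ∈ Finset.range τ,
      ∫ ω, (8 * ‖θ (s + i) ω - θstar‖ ^ 2 + 32 * σ ^ 2) ∂μ ≤ 40 * B := by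
    intro i hi
    rw [integral_add ((hint _).const_mul 8) (integrable_const _), integral_const_mul]
    have := hmoment (s + i) (by have := Finset.mem_range.mp hi; omega)
    simp only [integral_const, probReal_univ, one_smul]
    linarith
  calc ∫ ω, ‖θ (s + τ) ω - θ s ω‖ ^ 2 ∂μ
      ≤ ∫ ω, α ^ 2 * τ *
          ∑ i ∈ Finset.range τ, (8 * ‖θ (s + i) ω - θstar‖ ^ 2 + 32 * σ ^ 2) ∂μ :=
        integral_mono_of_nonneg (.of_forall fun ω => sq_nonneg _)
          ((integrable_finsetSum _ fun i _ => hterm i).const_mul _)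
          (.of_forall fun ω => norm_sub_sq_le_of_linear_growth (fun k => θ k ω)
            (fun k => g k ω (θ k ω)) θstar σ α (fun k => hrec k ω) (fun k => hg k ω _) s τ)
    _ = α ^ 2 * τ * ∑ i ∈ Finset.range τ,
          ∫ ω, (8 * ‖θ (s + i) ω - θstar‖ ^ 2 + 32 * σ ^ 2) ∂μ := by
        rw [integral_const_mul, integral_finsetSum _ fun i _ => hterm i]
    _ ≤ α ^ 2 * τ * ∑ _i ∈ Finset.range τ, 40 * B :=
        mul_le_mul_of_nonneg_left (Finset.sum_le_sum hbound) (by positivity)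
    _ = 40 * α ^ 2 * (τ : ℝ) ^ 2 * B := by
        rw [Finset.sum_const, Finset.card_range, nsmul_eq_mul]
        ring
end

section
/- Let θ*, θ ∈ ℝ^d, let L, σ ≥ 1, β > 0, α > 0, and let X be an element of a set 𝒳. Suppose g : ℝ^d × 𝒳 → ℝ^d satisfies ‖g(θ; X)‖ ≤ L(‖θ‖ + σ), and ḡ : ℝ^d → ℝ^d satisfies ⟨θ − θ*, ḡ(θ) − ḡ(θ*)⟩ ≤ −β‖θ − θ*‖² and ḡ(θ*) = 0. Then the updated point θ⁺ = θ + α g(θ; X) satisfies ‖θ⁺ − θ*‖² ≤ (1 − 2αβ + 2α²L²)‖θ − θ*‖² + 2α²L²(‖θ*‖ + σ)² + 2α⟨θ − θ*, g(θ; X) − ḡ(θ)⟩. -/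
open RealInnerProductSpace

/-- One-step inequality for general nonlinear stochastic
approximation: under the growth bound `‖g(θ; X)‖ ≤ L(‖θ‖ + σ)` and the strong
monotone property `⟨θ − θ*, ḡ(θ) − ḡ(θ*)⟩ ≤ −β‖θ − θ*‖²` with `ḡ(θ*) = 0`,
the updated point `θ⁺ = θ + α g(θ; X)` satisfies the main recursion
inequality. -/
theorem nonlinear_sa_one_step_recursion
    {d : ℕ} {𝒳 : Type*}
    (θstar θ : EuclideanSpace ℝ (Fin d))
    (L σ β α : ℝ) (hL : 1 ≤ L) (hσ : 1 ≤ σ) (hβ : 0 < β) (hα : 0 < α)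
    (X : 𝒳)
    (g : EuclideanSpace ℝ (Fin d) → 𝒳 → EuclideanSpace ℝ (Fin d))
    (gbar : EuclideanSpace ℝ (Fin d) → EuclideanSpace ℝ (Fin d))
    (hg : ‖g θ X‖ ≤ L * (‖θ‖ + σ))
    (hmono : ⟪θ - θstar, gbar θ - gbar θstar⟫ ≤ -β * ‖θ - θstar‖ ^ 2)
    (hroot : gbar θstar = 0) :
    ‖(θ + α • g θ X) - θstar‖ ^ 2 ≤
      (1 - 2 * α * β + 2 * α ^ 2 * L ^ 2) * ‖θ - θstar‖ ^ 2 +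
        2 * α ^ 2 * L ^ 2 * (‖θstar‖ + σ) ^ 2 +
        2 * α * ⟪θ - θstar, g θ X - gbar θ⟫ := by
  have hbound : ‖g θ X‖ ≤ L * (‖θ - θstar‖ + (‖θstar‖ + σ)) := by
    refine hg.trans (mul_le_mul_of_nonneg_left ?_ (by linarith))
    linarith [norm_le_norm_sub_add θ θstar]
  have hsq : ‖g θ X‖ ^ 2 ≤ 2 * L ^ 2 * (‖θ - θstar‖ ^ 2 + (‖θstar‖ + σ) ^ 2) :=
    calc ‖g θ X‖ ^ 2 ≤ (L * (‖θ - θstar‖ + (‖θstar‖ + σ))) ^ 2 := by gcongr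
      _ = L ^ 2 * (‖θ - θstar‖ + (‖θstar‖ + σ)) ^ 2 := mul_pow ..
      _ ≤ L ^ 2 * (2 * (‖θ - θstar‖ ^ 2 + (‖θstar‖ + σ) ^ 2)) := by
        gcongr
        exact add_sq_le
      _ = _ := by ring
  have hexp : ‖(θ + α • g θ X) - θstar‖ ^ 2 =
      ‖θ - θstar‖ ^ 2 + 2 * α * ⟪θ - θstar, g θ X⟫ + α ^ 2 * ‖g θ X‖ ^ 2 := by
    rw [add_sub_right_comm, norm_add_sq_real, real_inner_smul_right, norm_smul, mul_pow,
      Real.norm_eq_abs, sq_abs]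
    ring
  rw [hroot, sub_zero] at hmono
  rw [hexp, inner_sub_right]
  linear_combination (2 * α) * hmono + α ^ 2 * hsq
end
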